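/- Let G be a cograph with diameter 2 belonging to 𝒢₁(n, n−3) with n ≥ 5, let P₃ = v₁v₂v₃ be a diametrical path of G (so v₁ and v₃ are at distance 2), and suppose S_{{v₁,v₂}} = S_{{v₂,v₃}} = ∅. Then |S_{{v₁,v₃}}| ≤ 1. -/

import Mathlib

open Matrix

/-- The normalized Laplacian matrix of a finite simple graph. -/
noncomputable def normLap {V : Type*} [Fintype V] [DecidableEq V] (G : SimpleGraph V) [DecidableRel G.Adj] :
    Matrix V V ℝ :=
  Matrix.of fun u v =>
    if u = v then 1
    else if G.Adj u v then -1 / Real.sqrt ((G.degree u : ℝ) * (G.degree v : ℝ))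
    else 0

/-- The (geometric) multiplicity of `μ` as an eigenvalue of the matrix `M`. -/
noncomputable def eigMult {V : Type*} [Fintype V] [DecidableEq V]
    (M : Matrix V V ℝ) (μ : ℝ) : ℕ :=
  Module.finrank ℝ (LinearMap.ker (M - μ • (1 : Matrix V V ℝ)).mulVecLin)

/-- The multiset of eigenvalues (with multiplicity) of a hermitian matrix. -/
noncomputable def eigMultiset {V : Type*} [Fintype V] [DecidableEq V]
    (M : Matrix V V ℝ) : Multiset ℝ :=
  if h : M.IsHermitian then Finset.univ.val.map h.eigenvalues else 0

/-- The second-smallest eigenvalue (counted with multiplicity) of a hermitian matrix. -/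
noncomputable def secondSmallestEig {V : Type*} [Fintype V] [DecidableEq V]
    (M : Matrix V V ℝ) : ℝ :=
  ((eigMultiset M).sort (· ≤ ·)).getD 1 0

/-- The independence number of a finite simple graph. -/
noncomputable def indepNum {V : Type*} [Fintype V] (G : SimpleGraph V) : ℕ :=
  sSup {k | ∃ s : Finset V, (∀ u ∈ s, ∀ v ∈ s, u ≠ v → ¬ G.Adj u v) ∧ s.card = k}

/-- `G ∈ 𝒢₁(n, n-3)`. -/
def memG1Family {V : Type*} [Fintype V] [DecidableEq V]
    (G : SimpleGraph V) [DecidableRel G.Adj] (n : ℕ) : Prop :=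
  G.Connected ∧ Fintype.card V = n ∧
    (∃ θ : ℝ, eigMult (normLap G) θ = n - 3) ∧
    secondSmallestEig (normLap G) ≠ 1 ∧
    indepNum G = 2

/-- `v₁v₂v₃v₄` is an induced path `P₄`. -/
def IsInducedP4 {V : Type*} (G : SimpleGraph V) (v1 v2 v3 v4 : V) : Prop :=
  G.Adj v1 v2 ∧ G.Adj v2 v3 ∧ G.Adj v3 v4 ∧
    ¬ G.Adj v1 v3 ∧ ¬ G.Adj v1 v4 ∧ ¬ G.Adj v2 v4

/-- A cograph: no induced path on 4 vertices. -/
def IsCograph {V : Type*} (G : SimpleGraph V) : Prop :=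
  ∀ a b c d : V, ¬ IsInducedP4 G a b c d

/-- `S_U`: vertices outside the path `P` whose neighborhood inside `P` is exactly `U`. -/
def Sset {V : Type*} (G : SimpleGraph V) (P U : Set V) : Set V :=
  {u | u ∉ P ∧ G.neighborSet u ∩ P = U}

/-- The graph `G₁`: two cliques `A` (of size `a+1`) and `B` (of size `b+1`) forming a complete
graph together, a vertex `u` joined to all of `A` and a vertex `w` joined to all of `B`. -/
def graphG1 (a b : ℕ) : SimpleGraph (Unit ⊕ (Fin (a + 1) ⊕ (Fin (b + 1) ⊕ Unit))) :=
  SimpleGraph.fromRel fun x y =>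
    match x, y with
    | Sum.inl _, Sum.inr (Sum.inl _) => True
    | Sum.inr (Sum.inl _), Sum.inr (Sum.inl _) => True
    | Sum.inr (Sum.inl _), Sum.inr (Sum.inr (Sum.inl _)) => True
    | Sum.inr (Sum.inr (Sum.inl _)), Sum.inr (Sum.inr (Sum.inl _)) => True
    | Sum.inr (Sum.inr (Sum.inl _)), Sum.inr (Sum.inr (Sum.inr _)) => True
    | _, _ => False

noncomputable instance (a b : ℕ) : DecidableRel (graphG1 a b).Adj := Classical.decRel _

/-- The graph `G₂` on `m + 2` vertices: a complete graph on `m + 1` vertices together with a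
pendant vertex attached to one of its vertices. -/
def graphG2 (m : ℕ) : SimpleGraph (Unit ⊕ Fin (m + 1)) :=
  SimpleGraph.fromRel fun x y =>
    match x, y with
    | Sum.inl _, Sum.inr j => j = 0
    | Sum.inr _, Sum.inr _ => True
    | _, _ => False

noncomputable instance (m : ℕ) : DecidableRel (graphG2 m).Adj := Classical.decRel _

/-- The join of a single vertex with the disjoint union of two complete graphs `K_m`. -/
def joinTwoCliques (m : ℕ) : SimpleGraph (Unit ⊕ (Fin m ⊕ Fin m)) :=
  SimpleGraph.fromRel fun x y =>
    match x, y with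
    | Sum.inl _, Sum.inr _ => True
    | Sum.inr (Sum.inl _), Sum.inr (Sum.inl _) => True
    | Sum.inr (Sum.inr _), Sum.inr (Sum.inr _) => True
    | _, _ => False

noncomputable instance (m : ℕ) : DecidableRel (joinTwoCliques m).Adj := Classical.decRel _

/-- The matrix `c D - A`, where `D` is the degree matrix and `A` the adjacency matrix. -/
noncomputable def scaledLap {V : Type*} [Fintype V] [DecidableEq V] (G : SimpleGraph V)
    [DecidableRel G.Adj] (c : ℝ) : Matrix V V ℝ :=
  Matrix.of fun u v => if u = v then c * G.degree u else if G.Adj u v then -1 else 0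

theorem scaledLap_eq {V : Type*} [Fintype V] [DecidableEq V] (G : SimpleGraph V)
    [DecidableRel G.Adj] (θ : ℝ) :
    scaledLap G (1 - θ) = Matrix.diagonal (fun v => √(G.degree v : ℝ)) *
      (normLap G - θ • (1 : Matrix V V ℝ)) * Matrix.diagonal (fun v => √(G.degree v : ℝ)) := by
  ext u v
  rw [Matrix.mul_diagonal, Matrix.diagonal_mul]
  by_cases h : u = v
  · subst h
    have hs : √(G.degree u : ℝ) * √(G.degree u : ℝ) = G.degree u :=
      Real.mul_self_sqrt (Nat.cast_nonneg _)
    simp only [scaledLap, normLap, Matrix.of_apply, Matrix.sub_apply, Matrix.smul_apply,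
      Matrix.one_apply_eq, if_true, smul_eq_mul, mul_one]
    linear_combination -(1 - θ) * hs
  · by_cases ha : G.Adj u v
    · have hu : 0 < √(G.degree u : ℝ) := Real.sqrt_pos.2
        (Nat.cast_pos.2 ((G.degree_pos_iff_exists_adj u).2 ⟨v, ha⟩))
      have hv : 0 < √(G.degree v : ℝ) := Real.sqrt_pos.2
        (Nat.cast_pos.2 ((G.degree_pos_iff_exists_adj v).2 ⟨u, ha.symm⟩))
      simp only [scaledLap, normLap, Matrix.of_apply, Matrix.sub_apply, Matrix.smul_apply,
        Matrix.one_apply_ne h, if_neg h, if_pos ha, smul_zero, sub_zero,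
        Real.sqrt_mul (Nat.cast_nonneg _)]
      field_simp
    · simp [scaledLap, normLap, h, ha]

theorem rank_scaledLap_add_eigMult_le {V : Type*} [Fintype V] [DecidableEq V] (G : SimpleGraph V)
    [DecidableRel G.Adj] (θ : ℝ) :
    (scaledLap G (1 - θ)).rank + eigMult (normLap G) θ ≤ Fintype.card V := by
  have h1 : (scaledLap G (1 - θ)).rank ≤ (normLap G - θ • (1 : Matrix V V ℝ)).rank := by
    rw [scaledLap_eq]
    exact (Matrix.rank_mul_le_left _ _).trans (Matrix.rank_mul_le_right _ _)
  have h2 := (normLap G - θ • (1 : Matrix V V ℝ)).mulVecLin.finrank_range_add_finrank_ker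
  rw [Module.finrank_fintype_fun_eq_card] at h2
  unfold eigMult
  rw [← h2]
  exact Nat.add_le_add_right h1 _

theorem Matrix.det_submatrix_eq_zero_of_rank_lt {m n K : Type*} [Fintype m] [Fintype n]
    [DecidableEq m] [DecidableEq n] [Field K] (M : Matrix n n K) (f g : m → n)
    (h : M.rank < Fintype.card m) : (M.submatrix f g).det = 0 := by
  by_contra hd
  have h1 := Matrix.rank_of_isUnit _ ((Matrix.isUnit_iff_isUnit_det _).2 (isUnit_iff_ne_zero.2 hd))
  have h2 : M.submatrix f g =
      (1 : Matrix n n K).submatrix f id * M * (1 : Matrix n n K).submatrix id g := by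
    ext i j
    simp [Matrix.mul_apply, Matrix.one_apply]
  have h3 : (M.submatrix f g).rank ≤ M.rank := by
    rw [h2]
    exact (Matrix.rank_mul_le_left _ _).trans (Matrix.rank_mul_le_right _ _)
  omega

theorem Matrix.det_fin_four {R : Type*} [CommRing R] (A : Matrix (Fin 4) (Fin 4) R) :
    A.det =
      A 0 0 * A 1 1 * A 2 2 * A 3 3 - A 0 0 * A 1 1 * A 2 3 * A 3 2
      - A 0 0 * A 1 2 * A 2 1 * A 3 3 + A 0 0 * A 1 2 * A 2 3 * A 3 1
      + A 0 0 * A 1 3 * A 2 1 * A 3 2 - A 0 0 * A 1 3 * A 2 2 * A 3 1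
      - A 0 1 * A 1 0 * A 2 2 * A 3 3 + A 0 1 * A 1 0 * A 2 3 * A 3 2
      + A 0 1 * A 1 2 * A 2 0 * A 3 3 - A 0 1 * A 1 2 * A 2 3 * A 3 0
      - A 0 1 * A 1 3 * A 2 0 * A 3 2 + A 0 1 * A 1 3 * A 2 2 * A 3 0
      + A 0 2 * A 1 0 * A 2 1 * A 3 3 - A 0 2 * A 1 0 * A 2 3 * A 3 1
      - A 0 2 * A 1 1 * A 2 0 * A 3 3 + A 0 2 * A 1 1 * A 2 3 * A 3 0
      + A 0 2 * A 1 3 * A 2 0 * A 3 1 - A 0 2 * A 1 3 * A 2 1 * A 3 0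
      - A 0 3 * A 1 0 * A 2 1 * A 3 2 + A 0 3 * A 1 0 * A 2 2 * A 3 1
      + A 0 3 * A 1 1 * A 2 0 * A 3 2 - A 0 3 * A 1 1 * A 2 2 * A 3 0
      - A 0 3 * A 1 2 * A 2 0 * A 3 1 + A 0 3 * A 1 2 * A 2 1 * A 3 0 := by
  simp [Matrix.det_succ_row_zero, Fin.sum_univ_succ, Fin.succAbove, Fin.ext_iff]
  ring

/-- If `c D - A` has rank at most `3`, then two nonadjacent vertices `a, b` of equal degree joined
to the disjoint union of a vertex `p` and an edge `u w` force these degree relations. -/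
theorem degree_relations_of_rank_le_three {V : Type*} [Fintype V] [DecidableEq V]
    (G : SimpleGraph V) [DecidableRel G.Adj] {c : ℝ} (hr : (scaledLap G c).rank ≤ 3)
    {a b p u w : V} (hdeg : G.degree a = G.degree b) (hne : a ≠ b) (hab : ¬ G.Adj a b)
    (hap : G.Adj a p) (hau : G.Adj a u) (haw : G.Adj a w)
    (hbp : G.Adj b p) (hbu : G.Adj b u) (hbw : G.Adj b w)
    (hpu' : p ≠ u) (hpw' : p ≠ w) (hpu : ¬ G.Adj p u) (hpw : ¬ G.Adj p w) (huw : G.Adj u w) :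
    c * G.degree u = -1 ∧ c * G.degree w = -1 ∧
      G.degree a * G.degree p = 2 * G.degree u * (G.degree p + G.degree u) := by
  have hz (f g : Fin 4 → V) : ((scaledLap G c).submatrix f g).det = 0 :=
    Matrix.det_submatrix_eq_zero_of_rank_lt _ _ _ (by simp; omega)
  have hdiag (v : V) : scaledLap G c v v = c * G.degree v := by simp [scaledLap]
  have hadj {x y : V} (h : G.Adj x y) : scaledLap G c x y = -1 ∧ scaledLap G c y x = -1 := by
    simp [scaledLap, h, h.symm, h.ne, h.ne']
  have hnon {x y : V} (h : x ≠ y) (h' : ¬ G.Adj x y) :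
      scaledLap G c x y = 0 ∧ scaledLap G c y x = 0 := by
    simp [scaledLap, h, h', h.symm, G.adj_comm y x]
  have hA := hz ![a, b, p, u] ![a, b, p, u]
  have hA' := hz ![a, b, p, w] ![a, b, p, w]
  have hB := hz ![a, b, p, u] ![a, b, p, w]
  have hC := hz ![a, p, u, w] ![a, p, u, w]
  simp only [Matrix.det_fin_four, Matrix.submatrix_apply, Matrix.cons_val, hdiag, hadj hap,
    hadj hau, hadj haw, hadj hbp, hadj hbu, hadj hbw, hadj huw, hnon hne hab, hnon hpu' hpu,
    hnon hpw' hpw, ← hdeg] at hA hA' hB hC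
  have hc : c ≠ 0 := by
    rintro rfl
    norm_num at hC
  have ha : (G.degree a : ℝ) ≠ 0 :=
    Nat.cast_ne_zero.2 ((G.degree_pos_iff_exists_adj a).2 ⟨p, hap⟩).ne'
  have hp : (G.degree p : ℝ) ≠ 0 :=
    Nat.cast_ne_zero.2 ((G.degree_pos_iff_exists_adj p).2 ⟨a, hap.symm⟩).ne'
  have hB' : c * G.degree a * (c * G.degree p) = 2 - 2 * (c * G.degree p) := by
    apply mul_left_cancel₀ (mul_ne_zero hc ha)
    linear_combination -hB
  have hcu : c * G.degree u = -1 := by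
    apply mul_left_cancel₀ (mul_ne_zero (mul_ne_zero hc ha) (mul_ne_zero hc hp))
    linear_combination -hA / 2 + c * G.degree a * (c * G.degree u) / 2 * hB'
  have hcw : c * G.degree w = -1 := by
    apply mul_left_cancel₀ (mul_ne_zero (mul_ne_zero hc ha) (mul_ne_zero hc hp))
    linear_combination -hA' / 2 + c * G.degree a * (c * G.degree w) / 2 * hB'
  refine ⟨hcu, hcw, ?_⟩
  have h : (G.degree a * G.degree p : ℝ) = 2 * G.degree u * (G.degree p + G.degree u) := by
    apply mul_left_cancel₀ (mul_ne_zero hc hc)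
    linear_combination hB' - (2 * (c * G.degree u) - 2 + 2 * c * G.degree p) * hcu
  exact_mod_cast h

theorem card_le_indepNum {V : Type*} [Fintype V] (G : SimpleGraph V) {s : Finset V}
    (hs : ∀ u ∈ s, ∀ v ∈ s, u ≠ v → ¬ G.Adj u v) : s.card ≤ indepNum G :=
  le_csSup ⟨Fintype.card V, by rintro k ⟨t, -, rfl⟩; exact t.card_le_univ⟩ ⟨s, hs, rfl⟩

theorem adj_of_indepNum_eq_two {V : Type*} [Fintype V] {G : SimpleGraph V} (hG : indepNum G = 2)
    {a b x : V} (hab : a ≠ b) (hxa : x ≠ a) (hxb : x ≠ b) (h1 : ¬ G.Adj a b) (h2 : ¬ G.Adj x a) :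
    G.Adj x b := by
  classical
  by_contra h3
  have h := card_le_indepNum G (s := {a, b, x}) (by
    simp only [Finset.mem_insert, Finset.mem_singleton]
    rintro u (rfl | rfl | rfl) v (rfl | rfl | rfl) <;> simp_all [G.adj_comm])
  rw [Finset.card_eq_three.2 ⟨a, b, x, hab, hxa.symm, hxb.symm, rfl⟩] at h
  omega

theorem degree_add_two_of_adj_iff {V : Type*} [Fintype V] [DecidableEq V] {G : SimpleGraph V}
    [DecidableRel G.Adj] {a b : V} (hne : a ≠ b) (h : ∀ x, G.Adj a x ↔ x ≠ a ∧ x ≠ b) :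
    G.degree a + 2 = Fintype.card V := by
  have h1 : G.neighborFinset a = ({a, b} : Finset V)ᶜ := by
    ext x
    simp [h]
  have h2 := Finset.card_add_card_compl ({a, b} : Finset V)
  rw [Finset.card_pair hne, ← h1, G.card_neighborFinset_eq_degree] at h2
  omega

theorem statement17 {V : Type*} [Fintype V] [DecidableEq V] (n : ℕ) (hn : 5 ≤ n)
    (G : SimpleGraph V) [DecidableRel G.Adj]
    (hG : memG1Family G n) (hco : IsCograph G) (hdiam : G.diam = 2)
    (v1 v2 v3 : V) (h12 : G.Adj v1 v2) (h23 : G.Adj v2 v3) (hdist : G.dist v1 v3 = 2)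
    (hS12 : Sset G {v1, v2, v3} {v1, v2} = ∅) (hS23 : Sset G {v1, v2, v3} {v2, v3} = ∅) :
    (Sset G {v1, v2, v3} {v1, v3}).ncard ≤ 1 := by
  obtain ⟨-, hcard, ⟨θ, hθ⟩, -, hind⟩ := hG
  have hr : (scaledLap G (1 - θ)).rank ≤ 3 := by
    have := rank_scaledLap_add_eigMult_le G θ
    omega
  have hne : v1 ≠ v3 := by
    rintro rfl
    simp at hdist
  have h13 : ¬ G.Adj v1 v3 := fun h => by
    rw [SimpleGraph.dist_eq_one_iff_adj.2 h] at hdist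
    omega
  have hjoin : ∀ x, x ≠ v1 → x ≠ v3 → G.Adj v1 x ∧ G.Adj v3 x := by
    intro x hx1 hx3
    by_cases hx2 : x = v2
    · subst hx2
      exact ⟨h12, h23.symm⟩
    by_contra hcon
    have hor : G.Adj x v1 ∨ G.Adj x v3 := by
      by_contra! h
      exact h.2 (adj_of_indepNum_eq_two hind hne hx1 hx3 h13 h.1)
    have hmem : ∀ U : Set V, x ∉ Sset G {v1, v2, v3} U → ¬ G.neighborSet x ∩ {v1, v2, v3} = U :=
      fun U h h' => h ⟨by simp [hx1, hx2, hx3], h'⟩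
    have e12 := hmem _ (hS12 ▸ Set.notMem_empty x)
    have e23 := hmem _ (hS23 ▸ Set.notMem_empty x)
    by_cases hx12 : G.Adj x v1
    · have hx32 : ¬ G.Adj x v3 := fun h => hcon ⟨hx12.symm, h.symm⟩
      by_cases hx22 : G.Adj x v2
      · apply e12
        ext y
        simp only [Set.mem_inter_iff, SimpleGraph.mem_neighborSet, Set.mem_insert_iff,
          Set.mem_singleton_iff]
        constructor
        · rintro ⟨h, rfl | rfl | rfl⟩ <;> simp_all
        · rintro (rfl | rfl) <;> simp_all
      · exact hco x v1 v2 v3 ⟨hx12, h12, h23, hx22, hx32, h13⟩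
    · have hx32 : G.Adj x v3 := hor.resolve_left hx12
      by_cases hx22 : G.Adj x v2
      · apply e23
        ext y
        simp only [Set.mem_inter_iff, SimpleGraph.mem_neighborSet, Set.mem_insert_iff,
          Set.mem_singleton_iff]
        constructor
        · rintro ⟨h, rfl | rfl | rfl⟩ <;> simp_all
        · rintro (rfl | rfl) <;> simp_all
      · exact hco x v3 v2 v1 ⟨hx32, h23.symm, h12.symm, hx22, hx12, fun h => h13 h.symm⟩
  have hd1 : G.degree v1 + 2 = Fintype.card V := degree_add_two_of_adj_iff hne fun x =>
    ⟨fun h => ⟨h.ne', fun h' => h13 (h' ▸ h)⟩, fun h => (hjoin x h.1 h.2).1⟩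
  have hd3 : G.degree v3 + 2 = Fintype.card V := degree_add_two_of_adj_iff hne.symm fun x =>
    ⟨fun h => ⟨h.ne', fun h' => h13 (h' ▸ h).symm⟩, fun h => (hjoin x h.2 h.1).2⟩
  have hdeg : G.degree v1 = G.degree v3 := by omega
  have key {p u w : V} (hp1 : p ≠ v1) (hp3 : p ≠ v3) (hu1 : u ≠ v1) (hu3 : u ≠ v3) (hw1 : w ≠ v1)
      (hw3 : w ≠ v3) := degree_relations_of_rank_le_three G hr (p := p) (u := u) (w := w) hdeg hne
    h13 (hjoin p hp1 hp3).1 (hjoin u hu1 hu3).1 (hjoin w hw1 hw3).1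
    (hjoin p hp1 hp3).2 (hjoin u hu1 hu3).2 (hjoin w hw1 hw3).2
  have hS : ∀ x ∈ Sset G {v1, v2, v3} {v1, v3}, x ≠ v1 ∧ x ≠ v2 ∧ x ≠ v3 ∧ ¬ G.Adj x v2 := by
    rintro x ⟨hx, hx'⟩
    simp only [Set.mem_insert_iff, Set.mem_singleton_iff, not_or] at hx
    refine ⟨hx.1, hx.2.1, hx.2.2, fun h => ?_⟩
    have : v2 ∈ ({v1, v3} : Set V) := hx' ▸ ⟨h, by simp⟩
    simp [h12.ne', h23.ne] at this
  by_contra hlt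
  obtain ⟨u, hu, w, hw, huw⟩ := (Set.one_lt_ncard (Set.toFinite _)).1 (not_le.1 hlt)
  obtain ⟨hu1, hu2, hu3, huv⟩ := hS u hu
  obtain ⟨hw1, hw2, hw3, hwv⟩ := hS w hw
  have hauw : G.Adj u w :=
    adj_of_indepNum_eq_two hind hw2.symm hu2 huw (fun h => hwv h.symm) huv
  obtain ⟨hcu, -, hrel⟩ := key h12.ne' h23.ne hu1 hu3 hw1 hw3 hu2.symm hw2.symm
    (fun h => huv h.symm) (fun h => hwv h.symm) hauw
  have hdu : 0 < G.degree u := (G.degree_pos_iff_exists_adj u).2 ⟨w, hauw⟩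
  have hd2 : 0 < G.degree v2 := (G.degree_pos_iff_exists_adj v2).2 ⟨v3, h23⟩
  by_cases hall : ∀ x, x ≠ u → x ≠ v2 → G.Adj u x
  · have hdu' : G.degree u + 2 = Fintype.card V := degree_add_two_of_adj_iff hu2 fun x =>
      ⟨fun h => ⟨h.ne', fun h' => huv (h' ▸ h)⟩, fun h => hall x h.1 h.2⟩
    have : G.degree v1 = G.degree u := by omega
    rw [this] at hrel
    nlinarith
  · push Not at hall
    obtain ⟨x, hxu, hx2, hux⟩ := hall
    have hxv : G.Adj x v2 :=
      adj_of_indepNum_eq_two hind hu2 hxu hx2 huv (fun h => hux h.symm)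
    have hx1 : x ≠ v1 := fun h => hux (h ▸ (hjoin u hu1 hu3).1.symm)
    have hx3 : x ≠ v3 := fun h => hux (h ▸ (hjoin u hu1 hu3).2.symm)
    obtain ⟨-, hc2, -⟩ := key hu1 hu3 hx1 hx3 h12.ne' h23.ne hxu.symm hu2 hux huv hxv
    have hc : (1 - θ) ≠ 0 := fun h => by simp [h] at hcu
    have heq : G.degree v2 = G.degree u := by
      exact_mod_cast mul_left_cancel₀ hc (hc2.trans hcu.symm)
    have hcov : Fintype.card V ≤ G.degree u + G.degree v2 + 2 := by
      have hsub : (Finset.univ : Finset V) ⊆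
          (G.neighborFinset u ∪ G.neighborFinset v2) ∪ {u, v2} := by
        intro y _
        simp only [Finset.mem_union, SimpleGraph.mem_neighborFinset, Finset.mem_insert,
          Finset.mem_singleton]
        by_contra! h
        exact h.1.2 (adj_of_indepNum_eq_two hind hu2 h.2.1 h.2.2 huv
          (fun h' => h.1.1 h'.symm)).symm
      have h1 := Finset.card_le_card hsub
      have h2 := Finset.card_union_le (G.neighborFinset u ∪ G.neighborFinset v2) {u, v2}
      have h3 := Finset.card_union_le (G.neighborFinset u) (G.neighborFinset v2)
      rw [Finset.card_pair hu2] at h2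
      simp only [SimpleGraph.card_neighborFinset_eq_degree, Finset.card_univ] at h1 h2 h3
      omega
    rw [heq] at hrel hcov
    have : G.degree v1 ≤ 2 * G.degree u := by omega
    nlinarith
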